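/- arXiv:2002.06994 — 5 statements merged into one kernel-verified Lean document; each statement's English description precedes it below -/
import Mathlib

section
/- For every k ∈ ℕ, every prime p, and every ε > 0, there exist d ∈ ℕ with d > k, η > 0, Borel sets E, E′ ⊆ 𝕋^d, and an independent α ∈ 𝕋^d such that: (i) the translates E′, E′ + α, …, E′ + (p−1)α are mutually disjoint; (ii) μ(E) > (1 − ε)/p, where μ is Haar probability measure on 𝕋^d; (iii) E + Hamm(k, η) ⊆ E′, and consequently E ⊆ E′ and E + nα ⊆ E′ for every n ∈ BH(α; k, η). -/
open MeasureTheory Filter Pointwise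

/-- The Bohr–Hamming ball `BH(α; k, ε)`: the set of `n ∈ ℤ` such that at most `k`
coordinates of `nα` differ from `0` by at least `ε`. -/
noncomputable def bohrHamming {d : ℕ} (α : Fin d → AddCircle (1 : ℝ)) (k : ℕ) (ε : ℝ) :
    Set ℤ :=
  {n : ℤ | Set.ncard {j : Fin d | ε ≤ ‖(n • α) j‖} ≤ k}

/-- The approximate Hamming ball `Hamm(k, η) ⊆ 𝕋^d`: points with at most `k`
coordinates at distance at least `η` from `0`. -/
def approxHamming (d k : ℕ) (η : ℝ) : Set (Fin d → AddCircle (1 : ℝ)) :=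
  {x | Set.ncard {j : Fin d | η ≤ ‖x j‖} ≤ k}


lemma aux_dense (d : ℕ) (β : Fin d → AddCircle (1 : ℝ)) (δ : ℝ) (hδ : 0 < δ) :
    ∃ α : Fin d → AddCircle (1 : ℝ), Dense (Set.range fun n : ℤ => n • α) ∧
      ∀ j, ‖α j - β j‖ < δ := by
  let B := TopologicalSpace.countableBasis (Fin d → AddCircle (1 : ℝ))
  have hB := TopologicalSpace.isBasis_countableBasis (Fin d → AddCircle (1 : ℝ))
  have hBc : B.Countable := TopologicalSpace.countable_countableBasis _
  have : Countable B := hBc.to_subtype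
  let f : B → Set (Fin d → AddCircle (1 : ℝ)) := fun U => {a | ∃ n : ℤ, n • a ∈ U.1}
  have ho : ∀ U, IsOpen (f U) := by
    intro U
    have : f U = ⋃ n : ℤ, (fun a => n • a) ⁻¹' U.1 := by ext; simp [f]
    rw [this]
    exact isOpen_iUnion fun n => (hB.isOpen U.2).preimage (by fun_prop)
  have hd : ∀ U, Dense (f U) := by
    intro U
    rw [Metric.dense_iff]
    intro x r hr
    obtain ⟨u, hu⟩ := TopologicalSpace.nonempty_of_mem_countableBasis U.2
    obtain ⟨n, hn⟩ := exists_nat_one_div_lt hr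
    have key : ∀ j, ∃ y : AddCircle (1 : ℝ), ‖y‖ < r ∧ (((n + 1 : ℕ) : ℤ)) • (x j + y) = u j := by
      intro j
      obtain ⟨t, ht, ht'⟩ : ∃ t : ℝ, |t| ≤ 1/2 ∧ (t : AddCircle (1:ℝ)) = u j - (((n + 1 : ℕ) : ℤ)) • x j := by
        obtain ⟨t, ht⟩ := QuotientAddGroup.mk_surjective (u j - (((n + 1 : ℕ) : ℤ)) • x j)
        refine ⟨t - round t, abs_sub_round t, ?_⟩
        rw [← ht]
        have : ((round t : ℝ) : AddCircle (1:ℝ)) = 0 := by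
          rw [AddCircle.coe_eq_zero_iff]; exact ⟨round t, by simp⟩
        rw [AddCircle.coe_sub, this, sub_zero]
      have hn0 : (0:ℝ) < n + 1 := by positivity
      refine ⟨((t / (n+1) : ℝ) : AddCircle (1:ℝ)), ?_, ?_⟩
      · calc _ ≤ |t / (n+1)| := by
              rw [UnitAddCircle.norm_eq]
              simpa using round_le (t/(n+1)) 0
          _ ≤ 1 / (n+1) := by
              rw [abs_div, abs_of_pos hn0]; gcongr; linarith
          _ < r := hn
      · rw [smul_add, ← AddCircle.coe_zsmul]
        have : (((n + 1 : ℕ) : ℤ)) • (t / (n+1)) = t := by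
          simp; field_simp
        rw [this, ht']; abel
    choose y hy hy' using key
    refine ⟨fun j => x j + y j, ?_, ((n+1 : ℕ) : ℤ), ?_⟩
    · rw [Metric.mem_ball, dist_pi_lt_iff hr]
      intro j
      simpa [dist_eq_norm] using hy j
    · convert hu using 1
      ext j; exact hy' j
  have hD := dense_iInter_of_isOpen ho hd
  obtain ⟨α, hα, hα'⟩ := (Metric.dense_iff.1 hD) β δ hδ
  refine ⟨α, ?_, fun j => ?_⟩
  · rw [hB.dense_iff]
    intro U hU _
    obtain ⟨n, hn⟩ := Set.mem_iInter.1 hα' ⟨U, hU⟩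
    exact ⟨_, hn, n, rfl⟩
  · rw [Metric.mem_ball, dist_pi_lt_iff hδ] at hα
    simpa [dist_eq_norm] using hα j

lemma aux_fourier_int (m : ℤ) : ∫ θ : AddCircle (1:ℝ), (fourier m θ : ℂ) = if m = 0 then 1 else 0 := by
  have h := fourierCoeff_fourier (T := 1) m
  have h2 := congrFun h 0
  simp only [fourierCoeff, neg_zero, fourier_zero, one_smul] at h2
  rw [AddCircle.integral_haarAddCircle] at h2
  simp only [inv_one, one_smul] at h2
  rw [h2]
  by_cases hm : m = 0
  · subst hm; simp
  · simp [hm, Ne.symm hm]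

lemma aux_anti (g : AddCircle (1:ℝ) → ℤ) (hg : Measurable g)
    (hF : ∀ᵐ θ : AddCircle (1:ℝ), ‖∫ x : AddCircle (1:ℝ), (fourier (g x) θ : ℂ)‖ < 1) (s : ℤ) :
    Tendsto (fun d : ℕ => (volume : Measure (Fin d → AddCircle (1:ℝ))).real {x | ∑ j, g (x j) = s})
      atTop (nhds 0) := by
  have hmeasF : Measurable (fun q : ℤ × AddCircle (1:ℝ) => (fourier q.1 q.2 : ℂ)) :=
    measurable_from_prod_countable_right fun n => (fourier n).continuous.measurable
  have hm2 : Measurable (fun q : AddCircle (1:ℝ) × AddCircle (1:ℝ) => (fourier (g q.2) q.1 : ℂ)) :=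
    hmeasF.comp ((hg.comp measurable_snd).prodMk measurable_fst)
  have hFm : AEStronglyMeasurable (fun θ : AddCircle (1:ℝ) => ∫ x : AddCircle (1:ℝ), (fourier (g x) θ : ℂ)) volume :=
    hm2.stronglyMeasurable.integral_prod_right'.aestronglyMeasurable
  have hlim : Tendsto (fun d : ℕ => ∫ θ : AddCircle (1:ℝ), ‖∫ x : AddCircle (1:ℝ), (fourier (g x) θ : ℂ)‖ ^ d)
      atTop (nhds 0) := by
    have := tendsto_integral_of_dominated_convergence (μ := (volume : Measure (AddCircle (1:ℝ))))
      (F := fun (d : ℕ) θ => ‖∫ x : AddCircle (1:ℝ), (fourier (g x) θ : ℂ)‖ ^ d) (f := fun _ => 0)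
      (fun _ => (1:ℝ)) (fun d => (hFm.norm.pow d)) (integrable_const _)
      (fun d => by
        filter_upwards [hF] with θ hθ
        rw [norm_pow, norm_norm]
        exact pow_le_one₀ (norm_nonneg _) hθ.le)
      (by
        filter_upwards [hF] with θ hθ
        exact tendsto_pow_atTop_nhds_zero_of_lt_one (norm_nonneg _) hθ)
    simpa using this
  refine squeeze_zero (fun _ => measureReal_nonneg) (fun d => ?_) hlim
  let S : (Fin d → AddCircle (1:ℝ)) → ℤ := fun x => ∑ j, g (x j)
  have hS : Measurable S := by
    refine Finset.measurable_sum _ fun j _ => hg.comp (measurable_pi_apply j)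
  have hnorm : ∀ (m : ℤ) (θ : AddCircle (1:ℝ)), ‖(fourier m θ : ℂ)‖ = 1 := by
    intro m θ; rw [fourier_apply]; exact Circle.norm_coe _
  have hm3 : Measurable (fun q : (Fin d → AddCircle (1:ℝ)) × AddCircle (1:ℝ) => (fourier (S q.1 - s) q.2 : ℂ)) :=
    hmeasF.comp (((hS.comp measurable_fst).sub_const s).prodMk measurable_snd)
  have hint : Integrable (fun q : (Fin d → AddCircle (1:ℝ)) × AddCircle (1:ℝ) => (fourier (S q.1 - s) q.2 : ℂ))
      (volume.prod volume) := by
    refine (integrable_const (1:ℝ)).mono' hm3.aestronglyMeasurable (ae_of_all _ fun q => (hnorm _ _).le)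
  have hms : MeasurableSet {x | S x = s} := hS (measurableSet_singleton s)
  have e1 : ((volume.real {x | S x = s} : ℝ) : ℂ) = ∫ x, ∫ θ : AddCircle (1:ℝ), (fourier (S x - s) θ : ℂ) := by
    simp_rw [aux_fourier_int, sub_eq_zero]
    have : ∀ x, (if S x = s then (1:ℂ) else 0) = Set.indicator {x | S x = s} (fun _ => 1) x := by
      intro x; simp [Set.indicator_apply]
    simp_rw [this]
    rw [integral_indicator hms]; simp
  rw [integral_integral_swap hint] at e1
  have hprod : ∀ (x : Fin d → AddCircle (1:ℝ)) (θ : AddCircle (1:ℝ)), (fourier (S x - s) θ : ℂ) =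
      fourier (-s) θ * ∏ j, (fourier (g (x j)) θ : ℂ) := by
    intro x θ
    have : ∀ t : Finset (Fin d), (fourier (∑ j ∈ t, g (x j)) θ : ℂ) = ∏ j ∈ t, (fourier (g (x j)) θ : ℂ) := by
      intro t
      induction t using Finset.cons_induction with
      | empty => simp
      | cons a t ha ih => rw [Finset.sum_cons, Finset.prod_cons, fourier_add, ih]
    rw [← this, ← fourier_add, sub_eq_neg_add]
  have e2 : ((volume.real {x | S x = s} : ℝ) : ℂ) =
      ∫ θ : AddCircle (1:ℝ), fourier (-s) θ * (∫ x : AddCircle (1:ℝ), (fourier (g x) θ : ℂ)) ^ d := by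
    rw [e1]
    congr 1; ext θ
    simp_rw [hprod]
    rw [integral_const_mul, integral_fintype_prod_volume_eq_pow (fun y => (fourier (g y) θ : ℂ))]
    simp
  change volume.real {x | S x = s} ≤ _
  calc volume.real {x | S x = s} = ‖((volume.real {x | S x = s} : ℝ) : ℂ)‖ := by
        rw [Complex.norm_real, Real.norm_of_nonneg measureReal_nonneg]
    _ ≤ _ := by
      rw [e2]
      refine (norm_integral_le_integral_norm _).trans (le_of_eq ?_)
      congr 1; ext θ
      rw [norm_mul, hnorm, one_mul, norm_pow]

lemma aux_F (A B : Set (AddCircle (1:ℝ))) (hA : MeasurableSet A) (hB : MeasurableSet B) (a : ℝ)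
    (ha : 0 < a) (ha2 : a ≤ 1/2)
    (hAa : volume.real A = a) (hBa : volume.real B = a) (hAB : Disjoint A B) 
    (g : AddCircle (1:ℝ) → ℤ) (hg : g = fun x => A.indicator 1 x - B.indicator 1 x) :
    ∀ᵐ θ : AddCircle (1:ℝ), ‖∫ x : AddCircle (1:ℝ), (fourier (g x) θ : ℂ)‖ < 1 := by
  have hfin : Set.Finite {θ : AddCircle (1:ℝ) | fourier 2 θ = (1:ℂ)} := by
    have : {θ : AddCircle (1:ℝ) | fourier 2 θ = (1:ℂ)} = {θ | (2:ℕ) • θ = 0} := by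
      ext θ
      simp only [Set.mem_ofPred_eq, fourier_apply]
      have : ((2:ℤ) • θ) = (2:ℕ) • θ := by norm_cast
      rw [this]
      constructor
      · intro h
        apply AddCircle.injective_toCircle (T := 1) one_ne_zero
        ext
        rw [h]; simp
      · intro h; rw [h]; simp
    rw [this]
    exact AddCircle.finite_torsion 1 (by norm_num)
  have hnull : ∀ᵐ θ : AddCircle (1:ℝ), (fourier 2 θ : ℂ) ≠ 1 := by
    have h0 : (volume : Measure (AddCircle (1:ℝ))) {θ : AddCircle (1:ℝ) | fourier 2 θ = (1:ℂ)} = 0 := by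
      rw [← Set.biUnion_of_singleton {θ : AddCircle (1:ℝ) | fourier 2 θ = (1:ℂ)},
        measure_biUnion_null_iff hfin.countable]
      intro x _
      rw [← Metric.closedBall_zero, AddCircle.volume_closedBall]
      simp
    rw [ae_iff]
    simpa using h0
  filter_upwards [hnull] with θ hθ
  set z : ℂ := fourier 1 θ with hz
  have hzn : ‖z‖ = 1 := by rw [hz, fourier_apply]; exact Circle.norm_coe _
  have hz2 : z * z ≠ 1 := by rw [hz, ← fourier_add]; exact hθ
  have e : ∀ x, (fourier (g x) θ : ℂ) = 1 + A.indicator (fun _ => z - 1) x +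
      B.indicator (fun _ => (starRingEnd ℂ) z - 1) x := by
    intro x
    rw [hg]
    by_cases h1 : x ∈ A
    · have h2 : x ∉ B := Set.disjoint_left.1 hAB h1
      simp [h1, h2, hz]
    · by_cases h2 : x ∈ B
      · simp only [h1, h2, hz, Set.indicator_of_notMem, Set.indicator_of_mem, not_false_iff, Pi.one_apply, zero_sub]
        rw [fourier_neg]; ring
      · simp [h1, h2]
  simp_rw [e]
  rw [integral_add, integral_add, integral_indicator hA, integral_indicator hB]
  rotate_left
  · exact integrable_const _
  · exact (integrable_const _).indicator hA
  · exact (integrable_const _).add ((integrable_const _).indicator hA)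
  · exact (integrable_const _).indicator hB
  simp only [integral_const, measureReal_restrict_apply MeasurableSet.univ, Set.univ_inter, hAa, hBa]
  have hsq : z.re * z.re + z.im * z.im = 1 := by
    have := Complex.normSq_eq_norm_sq z
    rw [hzn, Complex.normSq_apply] at this; linarith
  have him : z.im ≠ 0 := by
    intro h0
    apply hz2
    rw [h0] at hsq
    apply Complex.ext
    · simp [h0]; linarith
    · simp [h0]
  have hp : 0 < z.im * z.im := mul_self_pos.2 him
  have : (volume.real (Set.univ : Set (AddCircle (1:ℝ))) • (1:ℂ) + a • (z - 1) + a • ((starRingEnd ℂ) z - 1))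
     = ((1 - 2 * a + 2 * a * z.re : ℝ) : ℂ) := by
    have hu : volume.real (Set.univ : Set (AddCircle (1:ℝ))) = 1 := by simp [Measure.real]
    rw [hu]
    apply Complex.ext
    · simp; ring
    · simp
  rw [this, Complex.norm_real, Real.norm_eq_abs, abs_lt]
  have hr1 : z.re < 1 := by nlinarith
  have hr2 : -1 < z.re := by nlinarith
  constructor <;> nlinarith

instance aux_prob1 : IsProbabilityMeasure (volume : Measure (AddCircle (1:ℝ))) := ⟨by simp⟩

instance aux_prob (d : ℕ) : IsProbabilityMeasure (volume : Measure (Fin d → AddCircle (1:ℝ))) := by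
  rw [volume_pi]; infer_instance

noncomputable def auxT (p : ℕ) [NeZero p] (c : ZMod p) : AddCircle (1:ℝ) := ZMod.toAddCircle c

lemma auxT_add (p : ℕ) [NeZero p] (a b : ZMod p) : auxT p (a + b) = auxT p a + auxT p b :=
  map_add (ZMod.toAddCircle (N := p)) a b

lemma auxT_sub (p : ℕ) [NeZero p] (a b : ZMod p) : auxT p (a - b) = auxT p a - auxT p b :=
  map_sub (ZMod.toAddCircle (N := p)) a b

lemma auxT_zero (p : ℕ) [NeZero p] : auxT p 0 = 0 :=
  map_zero (ZMod.toAddCircle (N := p))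

lemma auxT_int (p : ℕ) [NeZero p] (n : ℤ) : auxT p (n : ZMod p) = n • auxT p 1 := by
  have := map_zsmul (ZMod.toAddCircle (N := p)) n 1
  rw [← zsmul_one n]; exact this

lemma auxT_norm (p : ℕ) [NeZero p] (c : ZMod p) (hc : c ≠ 0) : 1 / (p : ℝ) ≤ ‖auxT p c‖ := by
  have hp : 0 < p := Nat.pos_of_ne_zero (NeZero.ne p)
  have h0 : auxT p c ≠ 0 := by
    intro h
    exact hc (ZMod.toAddCircle_injective p (h.trans (auxT_zero p).symm))
  have h1 : p • auxT p c = 0 := by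
    have := map_nsmul (ZMod.toAddCircle (N := p)) p c
    rw [nsmul_eq_mul, CharP.cast_eq_zero, zero_mul] at this
    exact this.symm.trans (auxT_zero p)
  have hfin : IsOfFinAddOrder (auxT p c) := isOfFinAddOrder_iff_nsmul_eq_zero.2 ⟨p, hp, h1⟩
  have h2 := AddCircle.le_add_order_smul_norm_of_isOfFinAddOrder hfin h0
  have h3 : addOrderOf (auxT p c) ≤ p := Nat.le_of_dvd hp (addOrderOf_dvd_of_nsmul_eq_zero h1)
  rw [div_le_iff₀ (by positivity)]
  rw [nsmul_eq_mul] at h2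
  calc (1:ℝ) ≤ _ := h2
    _ ≤ p * ‖auxT p c‖ := by gcongr
    _ = _ := mul_comm _ _

open Classical in
noncomputable def auxN (p d : ℕ) [NeZero p] (r : ℝ) (c : ZMod p) (x : Fin d → AddCircle (1:ℝ)) : ℕ :=
  (Finset.univ.filter fun j => ‖x j - auxT p c‖ < r).card

lemma auxN_meas (p d : ℕ) [NeZero p] (r : ℝ) (c : ZMod p) : Measurable (auxN p d r c) := by
  classical
  have : auxN p d r c = fun x => ∑ j, if x j ∈ Metric.ball (auxT p c) r then 1 else 0 := by
    ext x
    rw [auxN, Finset.card_filter]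
    simp [dist_eq_norm]
  rw [this]
  refine Finset.measurable_sum _ fun j _ => ?_
  exact Measurable.ite (measurable_pi_apply j Metric.isOpen_ball.measurableSet) measurable_const measurable_const

lemma aux_ball (x : AddCircle (1:ℝ)) (r : ℝ) (h0 : 0 ≤ r) (h1 : r ≤ 1/2) :
    volume.real (Metric.ball x r) = 2 * r := by
  rw [Measure.real, ← measure_congr AddCircle.closedBall_ae_eq_ball, AddCircle.volume_closedBall,
    min_eq_right (by linarith), ENNReal.toReal_ofReal (by linarith)]

lemma aux_close (p : ℕ) [NeZero p] (hp : 2 ≤ p) (K : ℕ) (c c' : ZMod p) (hc : c ≠ c') :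
    Tendsto (fun d : ℕ => (volume : Measure (Fin d → AddCircle (1:ℝ))).real
      {x | |(auxN p d (1/(2*p)) c x : ℤ) - auxN p d (1/(2*p)) c' x| ≤ K}) atTop (nhds 0) := by
  classical
  have hp' : (2:ℝ) ≤ p := by exact_mod_cast hp
  set R : ℝ := 1 / (2*p) with hR
  have hR0 : 0 < R := by positivity
  have hR1 : R ≤ 1/4 := by
    rw [hR]; apply one_div_le_one_div_of_le <;> linarith
  let A := Metric.ball (auxT p c) R
  let B := Metric.ball (auxT p c') R
  have hAm : MeasurableSet A := Metric.isOpen_ball.measurableSet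
  have hBm : MeasurableSet B := Metric.isOpen_ball.measurableSet
  let g : AddCircle (1:ℝ) → ℤ := fun x => A.indicator 1 x - B.indicator 1 x
  have hg : Measurable g :=
    (measurable_one.indicator hAm).sub (measurable_one.indicator hBm)
  have hAB : Disjoint A B := by
    apply Metric.ball_disjoint_ball
    rw [dist_eq_norm, ← auxT_sub]
    refine le_trans (le_of_eq ?_) (auxT_norm p _ (sub_ne_zero.2 hc))
    rw [hR]; field_simp; norm_num
  have hF := aux_F A B hAm hBm (2 * R) (by linarith) (by linarith)
    (aux_ball _ _ hR0.le (by linarith)) (aux_ball _ _ hR0.le (by linarith)) hAB g rfl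
  have hsum : ∀ d (x : Fin d → AddCircle (1:ℝ)), (auxN p d R c x : ℤ) - auxN p d R c' x = ∑ j, g (x j) := by
    intro d x
    simp only [auxN, Finset.card_filter, g, Finset.sum_sub_distrib]
    push_cast
    simp [A, B, Set.indicator_apply, dist_eq_norm]
  have hlim := tendsto_finsetSum (Finset.Icc (-(K:ℤ)) K) (fun s _ => aux_anti g hg hF s)
  rw [Finset.sum_const_zero] at hlim
  refine squeeze_zero (fun _ => measureReal_nonneg) (fun d => ?_) hlim
  refine le_trans (measureReal_mono ?_ (measure_ne_top _ _)) (measureReal_biUnion_finset_le _ _)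
  intro x hx
  have hx' : |(auxN p d R c x : ℤ) - auxN p d R c' x| ≤ K := hx
  rw [hsum, abs_le] at hx'
  simp only [Set.mem_iUnion]
  exact ⟨_, Finset.mem_Icc.2 hx', rfl⟩

def auxE (p d k : ℕ) [NeZero p] (R r : ℝ) (c : ZMod p) : Set (Fin d → AddCircle (1:ℝ)) :=
  {x | ∀ c', c' ≠ c → auxN p d R c' x + 2 * k < auxN p d r c x}

lemma auxE_meas (p d k : ℕ) [NeZero p] (R r : ℝ) (c : ZMod p) : MeasurableSet (auxE p d k R r c) := by
  have : auxE p d k R r c = ⋂ c', ⋂ (_ : c' ≠ c), {x | auxN p d R c' x + 2 * k < auxN p d r c x} := by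
    ext; simp [auxE]
  rw [this]
  exact MeasurableSet.iInter fun c' => MeasurableSet.iInter fun _ =>
    measurableSet_lt ((auxN_meas p d R c').add_const _) (auxN_meas p d r c)

lemma auxE_vol (p d k : ℕ) [NeZero p] (R r : ℝ) (c : ZMod p) :
    volume.real (auxE p d k R r c) = volume.real (auxE p d k R r 0) := by
  have hN : ∀ r c' x, auxN p d r c' (x + fun _ => - auxT p c) = auxN p d r (c' + c) x := by
    intro r c' x
    simp only [auxN, Pi.add_apply, auxT_add]
    congr! 4
    abel
  have : auxE p d k R r c = (fun x => x + fun _ => - auxT p c) ⁻¹' (auxE p d k R r 0) := by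
    ext x
    simp only [auxE, Set.mem_preimage, Set.mem_ofPred_eq, hN, zero_add]
    constructor
    · intro h c' hc'
      exact h _ (by simpa using hc')
    · intro h c' hc'
      have := h (c' - c) (sub_ne_zero.2 hc')
      simpa using this
  rw [this, Measure.real, measure_preimage_add_right, Measure.real]

lemma aux_cover (p d k : ℕ) [NeZero p] (R r : ℝ) (hr : r ≤ R) (x : Fin d → AddCircle (1:ℝ)) :
    (∃ c, x ∈ auxE p d k R r c) ∨
    (∃ q : ZMod p × ZMod p, q.1 ≠ q.2 ∧ |(auxN p d R q.1 x : ℤ) - auxN p d R q.2 x| ≤ (2 * k : ℕ)) ∨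
    (∃ q : Fin d × ZMod p, x q.1 ∈ Metric.ball (auxT p q.2) R \ Metric.ball (auxT p q.2) r) := by
  classical
  by_contra! h
  obtain ⟨h1, h2, h3⟩ := h
  obtain ⟨c, -, hc⟩ := Finset.exists_max_image Finset.univ (fun c => auxN p d R c x) ⟨0, Finset.mem_univ _⟩
  apply h1 c
  intro c' hc'
  have a1 := hc c' (Finset.mem_univ _)
  have a2 := h2 (c, c') hc'.symm
  have a3 : auxN p d R c x = auxN p d r c x := by
    unfold auxN
    congr 1
    ext j
    simp only [Finset.mem_filter, Finset.mem_univ, true_and]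
    constructor
    · intro h
      by_contra h'
      exact h3 (j, c) ⟨by simpa [dist_eq_norm] using h, by simpa [dist_eq_norm] using h'⟩
    · intro h; linarith
  dsimp at a1 a2
  rw [abs_of_nonneg (by omega)] at a2
  omega

lemma aux_disj (p d k : ℕ) [NeZero p] (R r : ℝ) (e e' : Fin d → AddCircle (1:ℝ))
    (he : e ∈ auxE p d k R r 0) (he' : e' ∈ auxE p d k R r 0) (c : ZMod p) (hc : c ≠ 0)
    (Z : Finset (Fin d)) (hZ : Z.card ≤ 2 * k) 
    (h : ∀ j ∉ Z, ‖e' j - e j - auxT p c‖ ≤ R - r) : False := by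
  classical
  have h1 : auxN p d r 0 e ≤ auxN p d R c e' + 2 * k := by
    unfold auxN
    refine le_trans (Finset.card_le_card (t := (Finset.univ.filter fun j => ‖e' j - auxT p c‖ < R) ∪ Z) ?_)
      ((Finset.card_union_le _ _).trans (by gcongr))
    intro j hj
    simp only [Finset.mem_filter, Finset.mem_univ, true_and, Finset.mem_union] at hj ⊢
    by_cases hjZ : j ∈ Z
    · exact Or.inr hjZ
    · left
      have := norm_add_le (e j - auxT p 0) (e' j - e j - auxT p c)
      have h2 := h j hjZ
      have e1 : (e j - auxT p 0) + (e' j - e j - auxT p c) = e' j - auxT p c := by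
        rw [auxT_zero]; abel
      rw [e1] at this
      linarith
  have h2 : auxN p d r 0 e' ≤ auxN p d R (-c) e + 2 * k := by
    unfold auxN
    refine le_trans (Finset.card_le_card (t := (Finset.univ.filter fun j => ‖e j - auxT p (-c)‖ < R) ∪ Z) ?_)
      ((Finset.card_union_le _ _).trans (by gcongr))
    intro j hj
    simp only [Finset.mem_filter, Finset.mem_univ, true_and, Finset.mem_union] at hj ⊢
    by_cases hjZ : j ∈ Z
    · exact Or.inr hjZ
    · left
      have := norm_sub_le (e' j - auxT p 0) (e' j - e j - auxT p c)
      have h2 := h j hjZ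
      have e1 : (e' j - auxT p 0) - (e' j - e j - auxT p c) = e j - auxT p (-c) := by
        rw [auxT_zero, ← zero_sub c, auxT_sub, auxT_zero]; abel
      rw [e1] at this
      linarith
  have h3 := he (-c) (neg_ne_zero.2 hc)
  have h4 := he' c hc
  omega

lemma aux_hamm_open (d k : ℕ) (η : ℝ) : 
    IsOpen {x : Fin d → AddCircle (1:ℝ) | Set.ncard {j : Fin d | η ≤ ‖x j‖} ≤ k} := by
  rw [isOpen_iff_mem_nhds]
  intro x hx
  have : ∀ j : Fin d, ∀ᶠ y in nhds x, η ≤ ‖y j‖ → η ≤ ‖x j‖ := by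
    intro j
    by_cases h : η ≤ ‖x j‖
    · exact Eventually.of_forall fun _ _ => h
    · have hc : Continuous fun y : Fin d → AddCircle (1:ℝ) => ‖y j‖ := by fun_prop
      filter_upwards [hc.continuousAt.eventually_lt_const (not_le.1 h)] with y hy hy'
      linarith
  filter_upwards [eventually_all.2 this] with y hy
  exact le_trans (Set.ncard_le_ncard (fun j hj => hy j hj) (Set.toFinite _)) hx

theorem stmt11 (k p : ℕ) (hp : p.Prime) (ε : ℝ) (hε : 0 < ε) :
    ∃ d : ℕ, k < d ∧ ∃ η : ℝ, 0 < η ∧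
      ∃ (E E' : Set (Fin d → AddCircle (1 : ℝ))) (α : Fin d → AddCircle (1 : ℝ)),
        MeasurableSet E ∧ MeasurableSet E' ∧
        -- α is independent, i.e. {nα : n ∈ ℤ} is dense in 𝕋^d
        Dense (Set.range fun n : ℤ => n • α) ∧
        -- (i) the translates E', E' + α, …, E' + (p-1)α are mutually disjoint
        (∀ i j : ℕ, i < p → j < p → i ≠ j →
          Disjoint ((fun x => x + (i : ℤ) • α) '' E')
            ((fun x => x + (j : ℤ) • α) '' E')) ∧
        -- (ii) μ(E) > (1 - ε)/p for the Haar probability measure on 𝕋^d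
        ENNReal.ofReal ((1 - ε) / p) < volume E ∧
        -- (iii) E + Hamm(k, η) ⊆ E', hence E ⊆ E' and E + nα ⊆ E' for n ∈ BH(α;k,η)
        E + approxHamming d k η ⊆ E' ∧ E ⊆ E' ∧
        (∀ n ∈ bohrHamming α k η, (fun x => x + n • α) '' E ⊆ E') := by
  classical
  obtain ⟨δ, hδ, hδ1, hδε⟩ : ∃ δ : ℝ, 0 < δ ∧ δ ≤ 1 ∧ δ ≤ ε :=
    ⟨min ε 1, by positivity, min_le_right _ _, min_le_left _ _⟩
  have : NeZero p := ⟨hp.ne_zero⟩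
  have hp2 : 2 ≤ p := hp.two_le
  have hp' : (2:ℝ) ≤ p := by exact_mod_cast hp2
  have hp0 : (0:ℝ) < p := by linarith
  have hδδ : 0 < δ / (4 * p ^ 2) := by positivity
  set R : ℝ := 1 / (2*p) with hR
  have hR0 : 0 < R := by positivity
  have hR1 : R ≤ 1/4 := by
    rw [hR]; apply one_div_le_one_div_of_le <;> linarith
  have hev : ∀ᶠ d : ℕ in atTop, ∀ q : ZMod p × ZMod p, q.1 ≠ q.2 →
      (volume : Measure (Fin d → AddCircle (1:ℝ))).real
        {x | |(auxN p d R q.1 x : ℤ) - auxN p d R q.2 x| ≤ (2 * k : ℕ)} < δ / (4 * p ^ 2) := by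
    rw [eventually_all]
    intro q
    by_cases hq : q.1 = q.2
    · exact Eventually.of_forall fun _ h => absurd hq h
    · filter_upwards [(aux_close p hp2 (2 * k) q.1 q.2 hq).eventually_lt_const hδδ] with d hd _
      exact hd
  obtain ⟨d, hd1, hkd⟩ := (hev.and (eventually_gt_atTop k)).exists
  have hd0 : (0:ℝ) < d := by exact_mod_cast (Nat.zero_le k).trans_lt hkd
  obtain ⟨η, hη, hη1, hη2⟩ : ∃ η : ℝ, 0 < η ∧ 3 * η ≤ R ∧ d * p * (6 * η) ≤ δ / 4 := by
    refine ⟨min (R / 3) (δ / (24 * d * p)), by positivity, ?_, ?_⟩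
    · have := min_le_left (R / 3) (δ / (24 * d * p)); linarith
    · calc d * p * (6 * min (R / 3) (δ / (24 * d * p))) ≤ d * p * (6 * (δ / (24 * d * p))) := by
            gcongr; exact min_le_right _ _
        _ = δ / 4 := by field_simp; norm_num
  obtain ⟨α, hα, hαc⟩ := aux_dense d (fun _ => auxT p 1) (η / p) (by positivity)
  set r : ℝ := R - 3 * η with hr
  set E := auxE p d k R r 0 with hE
  have hzero : (0 : Fin d → AddCircle (1:ℝ)) ∈ approxHamming d k η := by
    have : {j : Fin d | η ≤ ‖(0 : Fin d → AddCircle (1:ℝ)) j‖} = ∅ := by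
      ext j; simp [hη]
    change Set.ncard {j : Fin d | η ≤ ‖(0 : Fin d → AddCircle (1:ℝ)) j‖} ≤ k
    rw [this]; simp
  refine ⟨d, hkd, η, hη, E, E + approxHamming d k η, α, auxE_meas _ _ _ _ _ _,
    (IsOpen.add_left (aux_hamm_open d k η)).measurableSet, hα, ?_, ?_, subset_rfl, ?_, ?_⟩
  · intro i j hi hj hij
    rw [Set.disjoint_left]
    rintro _ ⟨_, ⟨e, he, h, hh, rfl⟩, rfl⟩ ⟨_, ⟨e', he', h', hh', rfl⟩, heq⟩
    have hh1 : Set.ncard {l : Fin d | η ≤ ‖h l‖} ≤ k := hh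
    have hh2 : Set.ncard {l : Fin d | η ≤ ‖h' l‖} ≤ k := hh'
    refine aux_disj p d k R r e e' he he' (((i:ℤ) - (j:ℤ) : ℤ) : ZMod p) ?_
      ({l : Fin d | η ≤ ‖h l‖} ∪ {l : Fin d | η ≤ ‖h' l‖}).toFinset ?_ ?_
    · intro h0
      push_cast at h0
      rw [sub_eq_zero, ZMod.natCast_eq_natCast_iff', Nat.mod_eq_of_lt hi, Nat.mod_eq_of_lt hj] at h0
      exact hij h0
    · rw [← Set.ncard_eq_toFinset_card']
      exact (Set.ncard_union_le _ _).trans (by omega)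
    · intro l hl
      rw [Set.mem_toFinset] at hl
      have hl1 : ‖h l‖ < η := by
        by_contra h0; exact hl (Or.inl (not_lt.1 h0))
      have hl2 : ‖h' l‖ < η := by
        by_contra h0; exact hl (Or.inr (not_lt.1 h0))
      have heq' := congrFun heq l
      simp only [Pi.add_apply, Pi.smul_apply] at heq'
      have e1 : e' l - e l - auxT p (((i:ℤ) - (j:ℤ) : ℤ) : ZMod p) =
          (h l - h' l) + ((i:ℤ) - (j:ℤ)) • (α l - auxT p 1) := by
        rw [auxT_int, smul_sub, sub_smul, sub_smul]
        have : e' l = e l + h l + (i:ℤ) • α l - (j:ℤ) • α l - h' l := by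
          rw [← heq']; abel
        rw [this]; abel
      have hab : |(((i:ℤ) - (j:ℤ) : ℤ) : ℝ)| ≤ p := by
        rw [abs_le]
        have : (i:ℝ) < p := by exact_mod_cast hi
        have : (j:ℝ) < p := by exact_mod_cast hj
        have : (0:ℝ) ≤ i := by positivity
        have : (0:ℝ) ≤ j := by positivity
        push_cast
        constructor <;> linarith
      have h3 : ‖((i:ℤ) - (j:ℤ)) • (α l - auxT p 1)‖ ≤ η := by
        calc _ ≤ |(((i:ℤ) - (j:ℤ) : ℤ) : ℝ)| * ‖α l - auxT p 1‖ := by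
              exact norm_zsmul_le ((i:ℤ) - (j:ℤ)) (α l - auxT p 1)
          _ ≤ p * (η / p) := by gcongr; exact (hαc l).le
          _ = η := by field_simp
      rw [e1]
      have h4 := norm_add_le (h l - h' l) (((i:ℤ) - (j:ℤ)) • (α l - auxT p 1))
      have h5 := norm_sub_le (h l) (h' l)
      linarith
  · have hvol : (1 - δ) / p < volume.real E := by
      let S1 : Set (Fin d → AddCircle (1:ℝ)) := ⋃ c, auxE p d k R r c
      let G : ZMod p × ZMod p → Set (Fin d → AddCircle (1:ℝ)) := fun q =>
        if q.1 ≠ q.2 then {x | |(auxN p d R q.1 x : ℤ) - auxN p d R q.2 x| ≤ (2 * k : ℕ)} else ∅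
      let H : Fin d × ZMod p → Set (Fin d → AddCircle (1:ℝ)) := fun q =>
        Function.eval q.1 ⁻¹' (Metric.ball (auxT p q.2) R \ Metric.ball (auxT p q.2) r)
      have hcov : (Set.univ : Set (Fin d → AddCircle (1:ℝ))) ⊆ S1 ∪ ((⋃ q, G q) ∪ ⋃ q, H q) := by
        intro x _
        rcases aux_cover p d k R r (by linarith) x with ⟨c, hc⟩ | ⟨q, hq, hq'⟩ | ⟨q, hq⟩
        · exact Or.inl (Set.mem_iUnion.2 ⟨c, hc⟩)
        · refine Or.inr (Or.inl (Set.mem_iUnion.2 ⟨q, ?_⟩))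
          simp only [G, if_pos hq]
          exact hq'
        · exact Or.inr (Or.inr (Set.mem_iUnion.2 ⟨q, hq⟩))
      have b1 : volume.real S1 ≤ p * volume.real E := by
        refine (measureReal_iUnion_fintype_le _).trans ?_
        simp_rw [auxE_vol]
        simp [ZMod.card, hE]
      have b2 : volume.real (⋃ q, G q) ≤ δ / 4 := by
        refine (measureReal_iUnion_fintype_le _).trans ?_
        calc ∑ q, volume.real (G q) ≤ ∑ q : ZMod p × ZMod p, δ / (4 * p ^ 2) := by
              refine Finset.sum_le_sum fun q _ => ?_
              by_cases hq : q.1 = q.2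
              · simp only [G, hq, ne_eq, not_true_eq_false, if_false, measureReal_empty]
                exact hδδ.le
              · simp only [G, ne_eq, hq, not_false_iff, if_true]
                exact (hd1 q hq).le
          _ = δ / 4 := by
              simp [ZMod.card]; field_simp
      have b3 : volume.real (⋃ q, H q) ≤ δ / 4 := by
        refine (measureReal_iUnion_fintype_le _).trans ?_
        calc ∑ q, volume.real (H q) = ∑ q : Fin d × ZMod p, 6 * η := by
              refine Finset.sum_congr rfl fun q _ => ?_
              have hm : MeasurableSet (Metric.ball (auxT p q.2) R \ Metric.ball (auxT p q.2) r) :=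
                Metric.isOpen_ball.measurableSet.diff Metric.isOpen_ball.measurableSet
              have hmp := (measurePreserving_eval
                (fun _ : Fin d => (volume : Measure (AddCircle (1:ℝ)))) q.1).measure_preimage
                hm.nullMeasurableSet
              have : volume.real (H q) =
                  volume.real (Metric.ball (auxT p q.2) R \ Metric.ball (auxT p q.2) r) := by
                simp only [Measure.real, H]
                rw [volume_pi, hmp]
              rw [this, measureReal_sdiff (Metric.ball_subset_ball (by linarith))
                Metric.isOpen_ball.measurableSet, aux_ball _ _ hR0.le (by linarith),
                aux_ball _ _ (by linarith) (by linarith)]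
              rw [hr]; ring
          _ = d * p * (6 * η) := by
              simp [ZMod.card]
          _ ≤ δ / 4 := hη2
      have t1 := measureReal_mono hcov (measure_ne_top (volume : Measure (Fin d → AddCircle (1:ℝ))) _)
      rw [probReal_univ] at t1
      have t2 := measureReal_union_le (μ := (volume : Measure (Fin d → AddCircle (1:ℝ)))) S1
        ((⋃ q, G q) ∪ ⋃ q, H q)
      have t3 := measureReal_union_le (μ := (volume : Measure (Fin d → AddCircle (1:ℝ))))
        (⋃ q, G q) (⋃ q, H q)
      rw [div_lt_iff₀ hp0]
      linarith
    have hE0 : volume E ≠ ⊤ := measure_ne_top _ _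
    rw [← ENNReal.ofReal_toReal hE0]
    have hnn : 0 ≤ (1 - δ) / p := div_nonneg (by linarith) hp0.le
    refine (ENNReal.ofReal_lt_ofReal_iff (hnn.trans_lt hvol)).2 (lt_of_le_of_lt ?_ hvol)
    gcongr
  · intro x hx
    exact ⟨x, hx, 0, hzero, add_zero x⟩
  · rintro n hn _ ⟨x, hx, rfl⟩
    exact ⟨x, hx, n • α, hn, rfl⟩
end

section
/- Let δ > 0. If S ⊆ ℤ is finite and δ-nonrecurrent, then for all sufficiently large N ∈ ℕ there is a set A ⊆ {0, …, N−1} with |A| > δN such that A ∩ (A + S) = ∅ and A + S ⊆ {0, …, N−1}. -/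
open Filter Pointwise

/-- Upper Banach density of a set of integers:
`d*(A) = limsup_{n→∞} sup_{k∈ℤ} |A ∩ {k+1,…,k+n}| / n`. -/
noncomputable def upperBanachDensity (A : Set ℤ) : ℝ :=
  Filter.atTop.limsup fun n : ℕ =>
    ⨆ k : ℤ, (Nat.card ↥(A ∩ Set.Ioc k (k + n)) : ℝ) / n

/-- A set `S ⊆ ℤ` is `δ`-nonrecurrent if there is `A ⊆ ℤ` with upper Banach density
`d*(A) > δ` such that `(A - A) ∩ S = ∅`. -/
def Nonrecurrent (δ : ℝ) (S : Set ℤ) : Prop :=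
  ∃ A : Set ℤ, δ < upperBanachDensity A ∧ (A - A) ∩ S = ∅

lemma cnt_fin (A : Set ℤ) (a b : ℤ) : (A ∩ Set.Ioc a b).Finite :=
  (Set.finite_Ioc a b).subset Set.inter_subset_right

lemma cnt_block (A : Set ℤ) (n : ℕ) (x : ℝ)
    (h : ∀ k : ℤ, ((A ∩ Set.Ioc k (k + n)).ncard : ℝ) ≤ x) (k : ℤ) (q : ℕ) :
    ((A ∩ Set.Ioc k (k + (q * n : ℕ))).ncard : ℝ) ≤ q * x := by
  induction q with
  | zero => simp
  | succ q ih =>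
    have h1 : A ∩ Set.Ioc k (k + ((q + 1) * n : ℕ)) ⊆
        (A ∩ Set.Ioc k (k + (q * n : ℕ))) ∪
          (A ∩ Set.Ioc (k + (q * n : ℕ)) (k + (q * n : ℕ) + n)) := by
      rintro a ⟨ha, h1, h2⟩
      by_cases h3 : a ≤ k + (q * n : ℕ)
      · exact Or.inl ⟨ha, h1, h3⟩
      · refine Or.inr ⟨ha, by omega, ?_⟩
        push_cast at *
        linarith
    have h2 := (Set.ncard_le_ncard h1 ((cnt_fin _ _ _).union (cnt_fin _ _ _))).trans
      (Set.ncard_union_le _ _)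
    have h3 := h (k + (q * n : ℕ))
    have h4 : ((A ∩ Set.Ioc k (k + ((q + 1) * n : ℕ))).ncard : ℝ) ≤
      ((A ∩ Set.Ioc k (k + (q * n : ℕ))).ncard : ℝ) +
          ((A ∩ Set.Ioc (k + (q * n : ℕ)) (k + (q * n : ℕ) + n)).ncard : ℝ) := by
      exact_mod_cast h2
    push_cast at *
    linarith

lemma exists_window (A : Set ℤ) (c : ℝ) (hc : 0 < c) (h : c < upperBanachDensity A)
    (n : ℕ) (hn : 0 < n) :
    ∃ k : ℤ, c * n < ((A ∩ Set.Ioc k (k + n)).ncard : ℝ) := by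
  by_contra! hcon
  obtain ⟨c', h1, h2⟩ := exists_between h
  unfold upperBanachDensity at h2
  have hf := Filter.frequently_lt_of_lt_limsup
    (Filter.isCoboundedUnder_le_of_le atTop (x := 0)
      (fun m => Real.iSup_nonneg fun k => by positivity)) h2
  obtain ⟨m, hm, hfm⟩ := (Filter.frequently_atTop.1 hf) (⌈c * n / (c' - c)⌉₊ + 1)
  obtain ⟨k, hk⟩ := exists_lt_of_lt_ciSup hfm
  have hm0 : (0 : ℝ) < m := by
    have : 0 < m := by omega
    exact_mod_cast this
  rw [lt_div_iff₀ hm0] at hk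
  change c' * m < ((A ∩ Set.Ioc k (k + m)).ncard : ℝ) at hk
  have hb := cnt_block A n (c * n) hcon k (m / n + 1)
  have hle : m ≤ (m / n + 1) * n := by
    have := Nat.lt_div_mul_add (a := m) hn
    nlinarith
  have hmono : (A ∩ Set.Ioc k (k + m)).ncard ≤
      (A ∩ Set.Ioc k (k + ((m / n + 1) * n : ℕ))).ncard := by
    apply Set.ncard_le_ncard _ (cnt_fin _ _ _)
    apply Set.inter_subset_inter_right
    apply Set.Ioc_subset_Ioc_right
    have : (m : ℤ) ≤ ((m / n + 1) * n : ℕ) := by exact_mod_cast hle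
    linarith
  have hmono' : ((A ∩ Set.Ioc k (k + m)).ncard : ℝ) ≤
      ((A ∩ Set.Ioc k (k + ((m / n + 1) * n : ℕ))).ncard : ℝ) := by exact_mod_cast hmono
  have hdiv : ((m / n : ℕ) : ℝ) * n ≤ m := by exact_mod_cast Nat.div_mul_le_self m n
  have hbig : c * n / (c' - c) ≤ m := by
    refine (Nat.le_ceil _).trans ?_
    exact_mod_cast (by omega : ⌈c * n / (c' - c)⌉₊ ≤ m)
  rw [div_le_iff₀ (by linarith)] at hbig
  have h5 : (((m / n + 1 : ℕ)) : ℝ) * (c * n) ≤ c * m + c * n := by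
    rw [Nat.cast_add, Nat.cast_one]
    nlinarith
  linarith

theorem stmt12 (δ : ℝ) (hδ : 0 < δ) (S : Set ℤ) (hSfin : S.Finite)
    (hS : Nonrecurrent δ S) :
    ∃ N₀ : ℕ, ∀ N : ℕ, N₀ ≤ N →
      ∃ A : Finset ℤ, (↑A : Set ℤ) ⊆ Set.Ico (0 : ℤ) N ∧
        δ * N < (A.card : ℝ) ∧
        (↑A ∩ (↑A + S) : Set ℤ) = ∅ ∧
        (↑A + S : Set ℤ) ⊆ Set.Ico (0 : ℤ) N := by
  obtain ⟨B, hB, hBS⟩ := hS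
  obtain ⟨c, h1, h2⟩ := exists_between hB
  obtain ⟨M, hM⟩ : ∃ M : ℕ, ∀ s ∈ S, |s| ≤ (M : ℤ) := by
    obtain ⟨u, hu⟩ := (hSfin.image fun s => |s|).bddAbove
    exact ⟨u.toNat, fun s hs => (hu ⟨s, hs, rfl⟩).trans (Int.self_le_toNat u)⟩
  refine ⟨⌈c * (2 * M) / (c - δ)⌉₊ + 2 * M + 1, fun N hN => ?_⟩
  obtain ⟨n, rfl⟩ : ∃ n, N = n + 2 * M := ⟨N - 2 * M, by omega⟩
  obtain ⟨k, hk⟩ := exists_window B c (by linarith) h2 n (by omega)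
  have hbig : c * (2 * M) / (c - δ) ≤ (n : ℝ) := by
    refine (Nat.le_ceil _).trans ?_
    exact_mod_cast (by omega : ⌈c * (2 * M) / (c - δ)⌉₊ ≤ n)
  rw [div_le_iff₀ (by linarith)] at hbig
  have hM0 : (0 : ℝ) ≤ M := by positivity
  have hmem : ∀ a : ℤ, a ∈ (cnt_fin B k (k + n)).toFinset.image (fun x => x - k - 1 + M) →
      (a + k + 1 - M ∈ B ∧ (M : ℤ) ≤ a ∧ a < M + n) := by
    intro a ha
    simp only [Finset.mem_image, Set.Finite.mem_toFinset] at ha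
    obtain ⟨x, ⟨hx, hx1, hx2⟩, rfl⟩ := ha
    refine ⟨?_, by omega, by omega⟩
    convert hx using 1
    ring
  refine ⟨(cnt_fin B k (k + n)).toFinset.image (fun x => x - k - 1 + M), ?_, ?_, ?_, ?_⟩
  · intro a ha
    obtain ⟨_, h3, h4⟩ := hmem a ha
    simp only [Set.mem_Ico]
    push_cast
    omega
  · rw [Finset.card_image_of_injective _ (fun x y hxy => by simpa using hxy),
      ← Set.ncard_eq_toFinset_card _ (cnt_fin B k (k + n))]
    push_cast
    nlinarith
  · rw [Set.eq_empty_iff_forall_notMem]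
    rintro a ⟨ha, b, hb, s, hs, hab⟩
    have h3 := (hmem a ha).1
    have h4 := (hmem b hb).1
    have : s ∈ (B - B) ∩ S := ⟨⟨_, h3, _, h4, by simp only at hab ⊢; omega⟩, hs⟩
    rw [hBS] at this
    exact this
  · rintro a ⟨b, hb, s, hs, rfl⟩
    obtain ⟨_, h3, h4⟩ := hmem b hb
    have h5 := abs_le.1 (hM s hs)
    simp only [Set.mem_Ico]
    push_cast
    omega
end

section
/- Let p be a prime. For every k ∈ ℕ and every ε > 0 there exist d ∈ ℕ and sets A, A₁ ⊆ (ℤ/pℤ)^d such that |A| > ((1 − ε)/p)·p^d, A ⊆ A₁, A + H_k ⊆ A₁, and the translates A₁, A₁ + 𝟏, …, A₁ + (p−1)𝟏 are mutually disjoint, where 𝟏 = (1, …, 1) ∈ (ℤ/pℤ)^d. -/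
open Pointwise

/-- The Hamming ball of radius `k` around `0` in `(ℤ/pℤ)^d`: elements with at
most `k` nonzero coordinates. -/
def hammingBall (p d k : ℕ) : Set (Fin d → ZMod p) :=
  {x | Set.ncard {j : Fin d | x j ≠ 0} ≤ k}

open Finset Filter Topology

def stepFn (p L : ℕ) (a b : ZMod p) (c : ZMod p) : ZMod L :=
  (if c = a then 1 else 0) - (if c = b then 1 else 0)

def cnt {p d : ℕ} (c : ZMod p) (x : Fin d → ZMod p) : ℕ :=
  (univ.filter (fun j => x j = c)).card

lemma sum_stepFn {p L d : ℕ} (a b : ZMod p) (x : Fin d → ZMod p) :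
    ∑ j, stepFn p L a b (x j) = (cnt a x : ZMod L) - (cnt b x : ZMod L) := by
  simp [stepFn, cnt, Finset.sum_sub_distrib]

lemma char_two {L : ℕ} [NeZero L] (hL : Odd L) (ψ : AddChar (ZMod L) ℂ) (hψ : ψ ≠ 0) :
    ψ 1 ≠ ψ (-1) := by
  intro h
  apply hψ
  have h2 : ψ 2 = 1 := by
    have : (2 : ZMod L) = 1 + 1 := by norm_num
    rw [this, AddChar.map_add_eq_mul]
    nth_rewrite 2 [h]
    rw [← AddChar.map_add_eq_mul]; simp
  obtain ⟨m, hm⟩ := hL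
  have h1 : ψ 1 = 1 := by
    have e : (1 : ZMod L) = (m + 1) • (2 : ZMod L) := by
      have : ((2 * m + 1 : ℕ) : ZMod L) = 0 := by rw [← hm]; simp
      push_cast at this
      simp only [nsmul_eq_mul]
      push_cast
      linear_combination - this
    rw [e, AddChar.map_nsmul_eq_pow, h2, one_pow]
  rw [AddChar.eq_zero_iff]
  intro x
  have : x = x.val • (1 : ZMod L) := by simp
  rw [this, AddChar.map_nsmul_eq_pow, h1, one_pow]

lemma norm_charSum_lt {p L : ℕ} [NeZero p] [NeZero L] (hL : Odd L) (a b : ZMod p) (hab : a ≠ b)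
    (ψ : AddChar (ZMod L) ℂ) (hψ : ψ ≠ 0) :
    ‖∑ c, ψ (stepFn p L a b c)‖ < p := by
  have hb : b ∈ (univ : Finset (ZMod p)).erase a := by simp [hab.symm]
  rw [← Finset.add_sum_erase univ _ (mem_univ a), ← Finset.add_sum_erase _ _ hb, ← add_assoc]
  have h1 : ‖ψ (stepFn p L a b a) + ψ (stepFn p L a b b)‖ < 2 := by
    have ea : stepFn p L a b a = 1 := by simp [stepFn, hab]
    have eb : stepFn p L a b b = -1 := by simp [stepFn, hab.symm]
    rw [ea, eb]
    have hne := char_two hL ψ hψ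
    have := norm_add_lt_of_not_sameRay (x := ψ 1) (y := ψ (-1))
      ((not_sameRay_iff_of_norm_eq (by simp [AddChar.norm_apply])).2 hne)
    simp only [AddChar.norm_apply] at this
    linarith
  have h2 : ‖∑ c ∈ ((univ : Finset (ZMod p)).erase a).erase b, ψ (stepFn p L a b c)‖
      ≤ (((univ : Finset (ZMod p)).erase a).erase b).card := by
    refine (norm_sum_le _ _).trans ?_
    simp [AddChar.norm_apply]
  have h3 : (((((univ : Finset (ZMod p)).erase a).erase b).card : ℕ) : ℝ) + 2 = p := by
    have e1 := Finset.card_erase_add_one hb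
    have e2 := Finset.card_erase_add_one (mem_univ a)
    rw [Finset.card_univ, ZMod.card] at e2
    have : (((univ : Finset (ZMod p)).erase a).erase b).card + 2 = p := by omega
    exact_mod_cast this
  have := norm_add_le (ψ (stepFn p L a b a) + ψ (stepFn p L a b b))
    (∑ c ∈ ((univ : Finset (ZMod p)).erase a).erase b, ψ (stepFn p L a b c))
  linarith

lemma count_eq {p L d : ℕ} [NeZero p] [NeZero L] (h : ZMod p → ZMod L) (r : ZMod L) :
    (L : ℂ) * ((univ.filter (fun x : Fin d → ZMod p => ∑ j, h (x j) = r)).card : ℂ)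
      = ∑ ψ : AddChar (ZMod L) ℂ, ψ (-r) * (∑ c, ψ (h c)) ^ d := by
  have e : ∀ ψ : AddChar (ZMod L) ℂ, ψ (-r) * (∑ c, ψ (h c)) ^ d
      = ∑ x : Fin d → ZMod p, ψ (∑ j, h (x j) - r) := by
    intro ψ
    have := Fintype.prod_sum (fun (_ : Fin d) (c : ZMod p) => ψ (h c))
    simp only [prod_const, card_univ, Fintype.card_fin] at this
    rw [this, Finset.mul_sum]
    refine Finset.sum_congr rfl fun x _ => ?_
    rw [sub_eq_add_neg, AddChar.map_add_eq_mul, mul_comm]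
    congr 1
    exact (map_prod ψ.toMonoidHom (fun j => Multiplicative.ofAdd (h (x j))) univ).symm
  simp_rw [e]
  rw [Finset.sum_comm]
  simp_rw [AddChar.sum_apply_eq_ite, sub_eq_zero]
  rw [← Finset.sum_filter]
  simp [mul_comm]

lemma count_le {p L d : ℕ} [NeZero p] [NeZero L] (h : ZMod p → ZMod L) (r : ZMod L) :
    (L : ℝ) * ((univ.filter (fun x : Fin d → ZMod p => ∑ j, h (x j) = r)).card : ℝ)
      ≤ ∑ ψ : AddChar (ZMod L) ℂ, ‖∑ c, ψ (h c)‖ ^ d := by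
  have := congrArg norm (count_eq (d := d) h r)
  simp only [norm_mul, Complex.norm_natCast] at this
  rw [this]
  refine (norm_sum_le _ _).trans (Finset.sum_le_sum fun ψ _ => ?_)
  simp [AddChar.norm_apply]

lemma anti {p L : ℕ} [NeZero p] [NeZero L] (hL : Odd L) (a b : ZMod p) (hab : a ≠ b) :
    ∀ᶠ d in atTop, ∀ r : ZMod L,
      (L : ℝ) * ((univ.filter (fun x : Fin d → ZMod p =>
        ∑ j, stepFn p L a b (x j) = r)).card : ℝ) ≤ 2 * (p : ℝ) ^ d := by
  classical
  have hp : (0 : ℝ) < p := by exact_mod_cast Nat.pos_of_ne_zero (NeZero.ne p)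
  have ht : Tendsto (fun d : ℕ => ∑ ψ ∈ (univ : Finset (AddChar (ZMod L) ℂ)).erase 0,
      (‖∑ c, ψ (stepFn p L a b c)‖ / p) ^ d) atTop (𝓝 (∑ ψ ∈ (univ : Finset (AddChar (ZMod L) ℂ)).erase 0, (0:ℝ))) := by
    refine tendsto_finset_sum _ fun ψ hψ => ?_
    refine tendsto_pow_atTop_nhds_zero_of_lt_one (by positivity) ?_
    rw [div_lt_one hp]
    exact norm_charSum_lt hL a b hab ψ (Finset.ne_of_mem_erase hψ)
  rw [Finset.sum_const_zero] at ht
  filter_upwards [ht.eventually_le_const (zero_lt_one)] with d hd r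
  refine (count_le _ r).trans ?_
  rw [← Finset.add_sum_erase univ _ (mem_univ (0 : AddChar (ZMod L) ℂ))]
  have h0 : ‖∑ c, (0 : AddChar (ZMod L) ℂ) (stepFn p L a b c)‖ ^ d = (p : ℝ) ^ d := by
    simp [ZMod.card]
  rw [h0]
  simp_rw [div_pow] at hd
  rw [← Finset.sum_div, div_le_one (by positivity)] at hd
  linarith

lemma bad_le {p L d k : ℕ} [NeZero p] [NeZero L] (a b : ZMod p)
    (h : ∀ r : ZMod L, (L : ℝ) * ((univ.filter (fun x : Fin d → ZMod p =>
        ∑ j, stepFn p L a b (x j) = r)).card : ℝ) ≤ 2 * (p : ℝ) ^ d) :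
    (L : ℝ) * ((univ.filter (fun x : Fin d → ZMod p =>
      cnt a x ≤ cnt b x + 2 * k ∧ cnt b x ≤ cnt a x + 2 * k)).card : ℝ)
      ≤ (4 * k + 1) * (2 * (p : ℝ) ^ d) := by
  have hsub : (univ.filter (fun x : Fin d → ZMod p =>
      cnt a x ≤ cnt b x + 2 * k ∧ cnt b x ≤ cnt a x + 2 * k)) ⊆
      (Finset.Icc (-(2 * k : ℤ)) (2 * k)).biUnion (fun m => univ.filter (fun x : Fin d → ZMod p =>
        ∑ j, stepFn p L a b (x j) = (m : ZMod L))) := by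
    intro x hx
    simp only [mem_filter, mem_univ, true_and] at hx
    simp only [mem_biUnion, mem_filter, mem_univ, true_and, mem_Icc]
    refine ⟨(cnt a x : ℤ) - cnt b x, by omega, ?_⟩
    rw [sum_stepFn]; push_cast; rfl
  have h1 := (Finset.card_le_card hsub).trans Finset.card_biUnion_le
  have h2 : ((univ.filter (fun x : Fin d → ZMod p =>
      cnt a x ≤ cnt b x + 2 * k ∧ cnt b x ≤ cnt a x + 2 * k)).card : ℝ) ≤
      ∑ m ∈ Finset.Icc (-(2 * k : ℤ)) (2 * k), ((univ.filter (fun x : Fin d → ZMod p =>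
        ∑ j, stepFn p L a b (x j) = (m : ZMod L))).card : ℝ) := by exact_mod_cast h1
  calc _ ≤ (L : ℝ) * _ := mul_le_mul_of_nonneg_left h2 (by positivity)
    _ = _ := Finset.mul_sum _ _ _
    _ ≤ ∑ m ∈ Finset.Icc (-(2 * k : ℤ)) (2 * k), 2 * (p : ℝ) ^ d :=
      Finset.sum_le_sum fun m _ => h _
    _ = _ := by
      rw [Finset.sum_const, Int.card_Icc, nsmul_eq_mul]
      congr 1
      have : ((2 * k + 1 - -(2 * k) : ℤ)).toNat = 4 * k + 1 := by omega
      rw [this]; push_cast; ring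

lemma cnt_shift {p d : ℕ} (c t : ZMod p) (x : Fin d → ZMod p) :
    cnt c (x + fun _ => t) = cnt (c - t) x := by
  unfold cnt
  congr 1
  ext j
  simp [eq_sub_iff_add_eq]

lemma cnt_le {p d k : ℕ} (c : ZMod p) (x y : Fin d → ZMod p)
    (h : Set.ncard {j : Fin d | x j ≠ y j} ≤ k) : cnt c x ≤ cnt c y + k := by
  classical
  have e : {j : Fin d | x j ≠ y j} = ((univ.filter (fun j => x j ≠ y j) : Finset (Fin d)) : Set (Fin d)) := by
    ext; simp
  rw [e, Set.ncard_coe_finset] at h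
  unfold cnt
  refine le_trans (Finset.card_le_card ?_) ((Finset.card_union_le _ _).trans (Nat.add_le_add_left h _))
  intro j
  simp only [mem_filter, mem_union, mem_univ, true_and]
  intro hj
  by_cases hxy : x j = y j
  · left; rw [← hxy, hj]
  · right; exact hxy

def goodSet (p d k : ℕ) [NeZero p] (i : ZMod p) : Finset (Fin d → ZMod p) :=
  univ.filter (fun x => ∀ c, c ≠ i → cnt c x + 2 * k < cnt i x)

lemma card_good {p d k : ℕ} [NeZero p] (i : ZMod p) :
    (goodSet p d k i).card ≤ (goodSet p d k 0).card := by
  refine Finset.card_le_card_of_injOn (fun x => x + fun _ => -i) ?_ ?_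
  · intro x hx
    simp only [goodSet, coe_filter, mem_univ, true_and, Set.mem_setOf_eq, cnt_shift] at hx ⊢
    intro c hc
    have := hx (c - -i) (by simpa using hc)
    simpa using this
  · intro x _ y _ h
    simpa using h

lemma good_card {p d k : ℕ} [NeZero p] {B : ℝ}
    (hB : ∀ a b : ZMod p, a ≠ b → ((univ.filter (fun x : Fin d → ZMod p =>
      cnt a x ≤ cnt b x + 2 * k ∧ cnt b x ≤ cnt a x + 2 * k)).card : ℝ) ≤ B) (hB0 : 0 ≤ B) :
    (p : ℝ) ^ d ≤ p * ((goodSet p d k 0).card : ℝ) + p ^ 2 * B := by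
  classical
  let bad : ZMod p × ZMod p → Finset (Fin d → ZMod p) := fun q =>
    if q.1 = q.2 then ∅ else univ.filter (fun x : Fin d → ZMod p =>
      cnt q.1 x ≤ cnt q.2 x + 2 * k ∧ cnt q.2 x ≤ cnt q.1 x + 2 * k)
  have hbad : ∀ q, ((bad q).card : ℝ) ≤ B := by
    intro q
    simp only [bad]
    split_ifs with h
    · simpa using hB0
    · exact hB _ _ h
  have hsub : (univ : Finset (Fin d → ZMod p)) ⊆
      (univ.biUnion (goodSet p d k)) ∪ (univ.biUnion bad) := by
    intro x _
    by_contra hx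
    simp only [mem_union, mem_biUnion, mem_univ, true_and, not_or, not_exists] at hx
    obtain ⟨h1, h2⟩ := hx
    obtain ⟨i, hi⟩ := Finite.exists_max (fun c : ZMod p => cnt c x)
    apply h1 i
    simp only [goodSet, mem_filter, mem_univ, true_and]
    intro c hc
    have h3 := h2 (c, i)
    simp only [bad, if_neg hc, mem_filter, mem_univ, true_and] at h3
    have := hi c
    omega
  have h := (Finset.card_le_card hsub).trans ((Finset.card_union_le _ _).trans
    (Nat.add_le_add Finset.card_biUnion_le Finset.card_biUnion_le))
  have h' : (p : ℝ) ^ d ≤ ∑ i, ((goodSet p d k i).card : ℝ) + ∑ q, ((bad q).card : ℝ) := by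
    have e : (univ : Finset (Fin d → ZMod p)).card = p ^ d := by simp [ZMod.card]
    rw [e] at h
    exact_mod_cast h
  refine h'.trans (add_le_add ?_ ?_)
  · refine (Finset.sum_le_sum (g := fun _ => ((goodSet p d k 0).card : ℝ)) fun i _ => by
      exact_mod_cast card_good i).trans ?_
    simp [ZMod.card]
  · refine (Finset.sum_le_sum fun i _ => hbad i).trans ?_
    simp [ZMod.card, sq]

theorem stmt15 (p : ℕ) (hp : p.Prime) (k : ℕ) (ε : ℝ) (hε : 0 < ε) :
    ∃ (d : ℕ) (A A₁ : Set (Fin d → ZMod p)),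
      ((1 - ε) / p) * (p : ℝ) ^ d < (A.ncard : ℝ) ∧
      A ⊆ A₁ ∧
      A + hammingBall p d k ⊆ A₁ ∧
      ∀ i j : ℕ, i < p → j < p → i ≠ j →
        Disjoint ((fun x => x + fun _ : Fin d => (i : ZMod p)) '' A₁)
          ((fun x => x + fun _ : Fin d => (j : ZMod p)) '' A₁) := by
  haveI : NeZero p := ⟨hp.ne_zero⟩
  have hp0 : (0 : ℝ) < p := by exact_mod_cast hp.pos
  obtain ⟨N, hN⟩ := exists_nat_gt ((p : ℝ) ^ 2 * ((4 * k + 1) * 2) / ε)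
  set L := 2 * N + 1 with hLdef
  have hLo : Odd L := ⟨N, rfl⟩
  haveI : NeZero L := ⟨by omega⟩
  have hL0 : (0 : ℝ) < L := by exact_mod_cast Nat.pos_of_ne_zero (NeZero.ne L)
  have hLN : (p : ℝ) ^ 2 * ((4 * k + 1) * 2) < ε * L := by
    rw [div_lt_iff₀ hε] at hN
    have : (N : ℝ) ≤ L := by exact_mod_cast (by omega : N ≤ L)
    nlinarith
  have hev : ∀ᶠ d in atTop, ∀ a b : ZMod p, a ≠ b → ∀ r : ZMod L,
      (L : ℝ) * ((univ.filter (fun x : Fin d → ZMod p =>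
        ∑ j, stepFn p L a b (x j) = r)).card : ℝ) ≤ 2 * (p : ℝ) ^ d := by
    simp only [eventually_all]
    intro a b hab
    exact eventually_all.1 (anti hLo a b hab)
  obtain ⟨d, hd⟩ := hev.exists
  have hP : (0 : ℝ) < (p : ℝ) ^ d := by positivity
  have hg := good_card (p := p) (d := d) (k := k) (B := (4 * k + 1) * (2 * (p : ℝ) ^ d) / L)
    (fun a b hab => by
      rw [le_div_iff₀ hL0, mul_comm]
      exact bad_le a b (hd a b hab)) (by positivity)
  refine ⟨d, goodSet p d k 0, {x | ∀ c, c ≠ 0 → cnt c x < cnt 0 x}, ?_, ?_, ?_, ?_⟩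
  · rw [Set.ncard_coe_finset, div_mul_eq_mul_div, div_lt_iff₀ hp0]
    have : (p : ℝ) ^ 2 * ((4 * k + 1) * (2 * (p : ℝ) ^ d) / L) < ε * (p : ℝ) ^ d := by
      rw [mul_div_assoc', div_lt_iff₀ hL0]
      nlinarith
    linarith
  · intro x hx c hc
    simp only [goodSet, coe_filter, mem_univ, true_and, Set.mem_setOf_eq] at hx
    have := hx c hc
    omega
  · rintro _ ⟨x, hx, h, hh, rfl⟩ c hc
    simp only [goodSet, coe_filter, mem_univ, true_and, Set.mem_setOf_eq] at hx
    have h0 := hx c hc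
    simp only [hammingBall, Set.mem_setOf_eq] at hh
    have h1 := cnt_le (k := k) c (x + h) x (by simpa using hh)
    have h2 := cnt_le (k := k) 0 x (x + h) (by simpa using hh)
    show cnt c (x + h) < cnt 0 (x + h)
    omega
  · intro i j hi hj hij
    rw [Set.disjoint_left]
    rintro _ ⟨x, hx, rfl⟩ ⟨y, hy, hxy⟩
    have hne : (i : ZMod p) ≠ (j : ZMod p) := by
      intro h
      rw [ZMod.natCast_eq_natCast_iff'] at h
      rw [Nat.mod_eq_of_lt hi, Nat.mod_eq_of_lt hj] at h
      exact hij h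
    simp only at hxy
    have e := fun c => congrArg (cnt c) hxy
    simp only [cnt_shift] at e
    have h1 := hx ((j : ZMod p) - i) (sub_ne_zero.2 hne.symm)
    have h2 := hy ((i : ZMod p) - j) (sub_ne_zero.2 hne)
    have e1 := e i
    have e2 := e j
    simp only [sub_self] at e1 e2
    omega
end

section
/- Let d₁, d₂ ∈ ℕ and let α ∈ 𝕋^{d₁} and β ∈ 𝕋^{d₂} be disjoint. If U ⊆ 𝕋^{d₁} and V ⊆ 𝕋^{d₂} are open and the Bohr neighborhoods B(α; U) := {n ∈ ℤ : nα ∈ U} and B(β; V) := {n ∈ ℤ : nβ ∈ V} are both nonempty, then B(α; U) ∩ B(β; V) = B((α, β); U × V) is nonempty (and hence is a nonempty Bohr neighborhood of rank at most d₁ + d₂). -/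
open Pointwise

/-- `α ∈ 𝕋^{d₁}` and `β ∈ 𝕋^{d₂}` are disjoint if the closure of the cyclic
subgroup generated by `(α, β)` equals the product of the closures of the cyclic
subgroups generated by `α` and by `β`. -/
def DisjointPair {d₁ d₂ : ℕ} (α : Fin d₁ → AddCircle (1 : ℝ))
    (β : Fin d₂ → AddCircle (1 : ℝ)) : Prop :=
  closure ((AddSubgroup.zmultiples (α, β) :
      AddSubgroup ((Fin d₁ → AddCircle (1 : ℝ)) × (Fin d₂ → AddCircle (1 : ℝ)))) : Set _) =
    (closure ((AddSubgroup.zmultiples α : AddSubgroup (Fin d₁ → AddCircle (1 : ℝ))) :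
        Set (Fin d₁ → AddCircle (1 : ℝ)))) ×ˢ
      (closure ((AddSubgroup.zmultiples β : AddSubgroup (Fin d₂ → AddCircle (1 : ℝ))) :
        Set (Fin d₂ → AddCircle (1 : ℝ))))

theorem stmt17 (d₁ d₂ : ℕ) (α : Fin d₁ → AddCircle (1 : ℝ))
    (β : Fin d₂ → AddCircle (1 : ℝ)) (hdisj : DisjointPair α β)
    (U : Set (Fin d₁ → AddCircle (1 : ℝ))) (V : Set (Fin d₂ → AddCircle (1 : ℝ)))
    (hU : IsOpen U) (hV : IsOpen V)
    (hBU : {n : ℤ | n • α ∈ U}.Nonempty) (hBV : {n : ℤ | n • β ∈ V}.Nonempty) :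
    ({n : ℤ | n • α ∈ U} ∩ {n : ℤ | n • β ∈ V}).Nonempty := by
  obtain ⟨m, hm⟩ := hBU
  obtain ⟨k, hk⟩ := hBV
  have hmem : (m • α, k • β) ∈ closure ((AddSubgroup.zmultiples (α, β) :
      AddSubgroup ((Fin d₁ → AddCircle (1 : ℝ)) × (Fin d₂ → AddCircle (1 : ℝ)))) : Set _) := by
    unfold DisjointPair at hdisj
    rw [hdisj]
    exact ⟨subset_closure (AddSubgroup.mem_zmultiples_iff.2 ⟨m, rfl⟩),
      subset_closure (AddSubgroup.mem_zmultiples_iff.2 ⟨k, rfl⟩)⟩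
  obtain ⟨x, hx, hxz⟩ := mem_closure_iff.1 hmem (U ×ˢ V) (hU.prod hV) ⟨hm, hk⟩
  obtain ⟨n, rfl⟩ := AddSubgroup.mem_zmultiples_iff.1 hxz
  exact ⟨n, hx.1, hx.2⟩
end

section
/- Let d ∈ ℕ and k < d. Given an independent α = (α₁, …, α_d) ∈ 𝕋^d and any β ∈ 𝕋^k, there are indices i₁ < i₂ < … < i_{d−k} such that α′ := (α_{i₁}, …, α_{i_{d−k}}) ∈ 𝕋^{d−k} and β are disjoint. -/
open Pointwise

theorem linalg {K V : Type*} [Field K] [AddCommGroup V] [Module K V] {d k : ℕ} (v : Fin d → V)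
    (hv : LinearIndependent K v) (W : Submodule K V) [FiniteDimensional K W]
    (hW : Module.finrank K W ≤ k) :
    ∃ ι : Fin (d - k) → Fin d, StrictMono ι ∧ LinearIndependent K (fun i => W.mkQ (v (ι i))) := by
  obtain ⟨κ, a, ha, hspan, hli⟩ := exists_linearIndependent' K (fun i => W.mkQ (v i))
  have : Fintype κ := Fintype.ofInjective a ha
  have h1 := finrank_span_eq_card hli
  rw [hspan] at h1
  have h2 := finrank_span_eq_card hv
  let f := W.mkQ.domRestrict (Submodule.span K (Set.range v))
  have : FiniteDimensional K (Submodule.span K (Set.range v)) :=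
    FiniteDimensional.span_of_finite K (Set.finite_range v)
  have h3 := LinearMap.finrank_range_add_finrank_ker f
  have h4 : LinearMap.range f = Submodule.span K (Set.range fun i => W.mkQ (v i)) := by
    rw [LinearMap.range_domRestrict, Submodule.map_span, ← Set.range_comp]; rfl
  have h5 : Module.finrank K (LinearMap.ker f) ≤ Module.finrank K W := by
    let g : LinearMap.ker f →ₗ[K] W := LinearMap.codRestrict W
      ((Submodule.subtype _).comp (Submodule.subtype _)) (by
        rintro ⟨x, hx⟩
        have : W.mkQ x = 0 := hx
        simpa using this)
    apply LinearMap.finrank_le_finrank_of_injective (f := g)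
    intro x y hxy
    have := congrArg Subtype.val hxy
    exact Subtype.ext (Subtype.ext this)
  rw [h4, h1, h2, Fintype.card_fin] at h3
  have h6 : d - k ≤ (Finset.univ.image a).card := by
    rw [Finset.card_image_of_injective _ ha, Finset.card_univ]; omega
  obtain ⟨s, hs, hc⟩ := Finset.exists_subset_card_eq h6
  refine ⟨s.orderEmbOfFin hc, (s.orderEmbOfFin hc).strictMono, ?_⟩
  have h7 : ∀ i, ∃ j, a j = s.orderEmbOfFin hc i := fun i => by
    have := hs (Finset.orderEmbOfFin_mem s hc i)
    simpa using this
  choose c hcc using h7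
  have h8 := hli.comp c (fun i j hij => (s.orderEmbOfFin hc).injective (by rw [← hcc, ← hcc, hij]))
  have h9 : (fun i => W.mkQ (v (s.orderEmbOfFin hc i))) = ((fun i => W.mkQ (v i)) ∘ a) ∘ c := by
    funext i
    simp only [Function.comp, hcc]
  rw [h9]
  exact h8


theorem mF_eq {ι : Type*} [Fintype ι] (n : ι → ℤ) (x : UnitAddTorus ι) :
    UnitAddTorus.mFourier n x = ((AddCircle.toCircle (∑ i, n i • x i) : Circle) : ℂ) := by
  classical
  have key : ∀ s : Finset ι, ∏ i ∈ s, (fourier (n i) (x i) : ℂ)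
      = ((AddCircle.toCircle (∑ i ∈ s, n i • x i) : Circle) : ℂ) := by
    intro s
    induction s using Finset.induction_on with
    | empty => simp
    | insert a s ha ih =>
      rw [Finset.prod_insert ha, Finset.sum_insert ha, ih, AddCircle.toCircle_add, fourier_apply]
      simp
  exact key Finset.univ

theorem mF_add {ι : Type*} [Fintype ι] (n : ι → ℤ) (x y : UnitAddTorus ι) :
    UnitAddTorus.mFourier n (x + y) = UnitAddTorus.mFourier n x * UnitAddTorus.mFourier n y := by
  simp [mF_eq, smul_add, Finset.sum_add_distrib, AddCircle.toCircle_add]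

theorem mF_one {ι : Type*} [Fintype ι] (n : ι → ℤ) (x : UnitAddTorus ι) :
    UnitAddTorus.mFourier n x = 1 ↔ ∑ i, n i • x i = 0 := by
  rw [mF_eq]
  constructor
  · intro h
    apply AddCircle.injective_toCircle (T := (1 : ℝ)) one_ne_zero
    rw [AddCircle.toCircle_zero]
    exact Circle.coe_eq_one.1 h
  · intro h
    rw [h]; simp

theorem kron {ι : Type*} [Fintype ι] (γ x : UnitAddTorus ι)
    (h : ∀ n : ι → ℤ, ∑ i, n i • γ i = 0 → ∑ i, n i • x i = 0) :
    x ∈ closure ((AddSubgroup.zmultiples γ : AddSubgroup (UnitAddTorus ι)) :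
      Set (UnitAddTorus ι)) := by
  set H := (AddSubgroup.zmultiples γ : AddSubgroup (UnitAddTorus ι)).topologicalClosure with hH
  have hHc : IsClosed (H : Set (UnitAddTorus ι)) :=
    AddSubgroup.isClosed_topologicalClosure _
  change x ∈ H
  by_contra hx
  have : CompactSpace H := isCompact_iff_compactSpace.mp hHc.isCompact
  let _ : MeasurableSpace H := borel H
  have : BorelSpace H := ⟨rfl⟩
  let μ : MeasureTheory.Measure H := MeasureTheory.Measure.addHaar
  have hγ : γ ∈ H := AddSubgroup.le_topologicalClosure _ (AddSubgroup.mem_zmultiples γ)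
  have hint : ∀ g : H → ℂ, Continuous g → MeasureTheory.Integrable g μ := fun g hg =>
    hg.integrable_of_hasCompactSupport (HasCompactSupport.of_compactSpace g)
  have key : ∀ g : C(UnitAddTorus ι, ℂ), ∫ t : H, g t ∂μ = ∫ t : H, g (t + x) ∂μ := by
    have hlip : ∀ y : UnitAddTorus ι,
        Continuous (fun g : C(UnitAddTorus ι, ℂ) => ∫ t : H, g (t + y) ∂μ) := by
      intro y
      refine LipschitzWith.continuous (K := (μ.real Set.univ).toNNReal)
        (LipschitzWith.of_dist_le_mul fun g g' => ?_)
      rw [dist_eq_norm, dist_eq_norm, ← MeasureTheory.integral_sub (hint _ (by fun_prop))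
        (hint _ (by fun_prop)), Real.coe_toNNReal _ MeasureTheory.measureReal_nonneg, mul_comm]
      exact MeasureTheory.norm_integral_le_of_norm_le_const
        (Filter.Eventually.of_forall fun t => (g - g').norm_coe_le_norm _)
    let S : Submodule ℂ C(UnitAddTorus ι, ℂ) :=
      { carrier := {g | ∫ t : H, g (t + 0) ∂μ = ∫ t : H, g (t + x) ∂μ}
        zero_mem' := by simp
        add_mem' := by
          intro a b ha hb
          simp only [Set.mem_ofPred_eq, ContinuousMap.add_apply] at *
          rw [MeasureTheory.integral_add (hint _ (by fun_prop)) (hint _ (by fun_prop)),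
            MeasureTheory.integral_add (hint _ (by fun_prop)) (hint _ (by fun_prop)), ha, hb]
        smul_mem' := by
          intro c a ha
          simp only [Set.mem_ofPred_eq, ContinuousMap.smul_apply] at *
          rw [MeasureTheory.integral_smul, MeasureTheory.integral_smul, ha] }
    have hScl : IsClosed (S : Set C(UnitAddTorus ι, ℂ)) := isClosed_eq (hlip 0) (hlip x)
    have hle : Submodule.span ℂ (Set.range (UnitAddTorus.mFourier (d := ι))) ≤ S := by
      rw [Submodule.span_le]
      rintro _ ⟨n, rfl⟩
      change ∫ t : H, UnitAddTorus.mFourier n (t + 0) ∂μ = ∫ t : H, UnitAddTorus.mFourier n (t + x) ∂μ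
      simp only [add_zero]
      simp_rw [mF_add]
      rw [MeasureTheory.integral_mul_const]
      by_cases hn : ∑ i, n i • γ i = 0
      · rw [(mF_one n x).2 (h n hn), mul_one]
      · have e : ∫ t : H, UnitAddTorus.mFourier n (t : UnitAddTorus ι) ∂μ
            = (∫ t : H, UnitAddTorus.mFourier n (t : UnitAddTorus ι) ∂μ) * UnitAddTorus.mFourier n γ := by
          rw [← MeasureTheory.integral_mul_const]
          simp_rw [← mF_add]
          exact (MeasureTheory.integral_add_right_eq_self
            (fun t : H => UnitAddTorus.mFourier n (t : UnitAddTorus ι)) ⟨γ, hγ⟩).symm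
        have e2 : UnitAddTorus.mFourier n γ ≠ 1 := fun h' => hn ((mF_one n γ).1 h')
        have e3 : ∫ t : H, UnitAddTorus.mFourier n (t : UnitAddTorus ι) ∂μ = 0 := by
          by_contra h0
          exact e2 (mul_left_cancel₀ h0 (by rw [← e, mul_one]))
        rw [e3, zero_mul]
    have htop : S = ⊤ := by
      rw [eq_top_iff, ← UnitAddTorus.span_mFourier_closure_eq_top]
      exact Submodule.topologicalClosure_minimal _ hle hScl
    intro g
    have hg : g ∈ S := htop ▸ Submodule.mem_top
    have hg' : ∫ t : H, g (t + 0) ∂μ = ∫ t : H, g (t + x) ∂μ := hg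
    simpa using hg'
  have hcl : IsClosed ((fun t => t - x) ⁻¹' (H : Set (UnitAddTorus ι))) :=
    hHc.preimage (by fun_prop)
  obtain ⟨f, f0, f1, -⟩ := exists_continuous_zero_one_of_isClosed hHc hcl (by
    rw [Set.disjoint_left]
    intro t ht ht'
    exact hx (by simpa using H.sub_mem ht ht'))
  have := key ⟨fun t => (f t : ℂ), by fun_prop⟩
  have c0 : ∀ t : H, f t = 0 := fun t => f0 t.2
  have c1 : ∀ t : H, f (t + x) = 1 := fun t => f1 (by simp)
  simp [c0, c1] at this
  have h0 : μ.real Set.univ = 0 := by exact_mod_cast this.symm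
  rw [MeasureTheory.measureReal_def, ENNReal.toReal_eq_zero_iff] at h0
  rcases h0 with h0 | h0
  · exact (isOpen_univ.measure_pos μ Set.univ_nonempty).ne' h0
  · exact MeasureTheory.measure_ne_top μ _ h0

theorem indep_of_dense {d : ℕ} (α : Fin d → AddCircle (1 : ℝ))
    (hα : Dense (Set.range fun n : ℤ => n • α)) (n : Fin d → ℤ) (h : ∑ i, n i • α i = 0) :
    n = 0 := by
  have hc : (fun x : Fin d → AddCircle (1 : ℝ) => ∑ i, n i • x i) = fun _ => 0 := by
    apply Continuous.ext_on hα (by fun_prop) (by fun_prop)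
    rintro _ ⟨m, rfl⟩
    simp only [Pi.smul_apply]
    simp_rw [smul_comm _ m]
    rw [← Finset.smul_sum, h, smul_zero]
  funext i
  by_contra hi
  have hi : n i ≠ 0 := hi
  have h1 := congrFun hc (Pi.single i (((1 / (2 * n i) : ℝ)) : AddCircle (1 : ℝ)))
  rw [Finset.sum_eq_single i (by intro j _ hj; simp [hj]) (by simp)] at h1
  rw [Pi.single_eq_same, ← AddCircle.coe_zsmul, AddCircle.coe_eq_zero_iff] at h1
  obtain ⟨m, hm⟩ := h1
  have hi' : (n i : ℝ) ≠ 0 := by exact_mod_cast hi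
  simp only [zsmul_eq_mul, mul_one] at hm
  field_simp at hm
  have : m * 2 = 1 := by exact_mod_cast hm
  omega

theorem coe_sum' {ι : Type*} (s : Finset ι) (n : ι → ℤ) (a : ι → ℝ) :
    ((∑ i ∈ s, n i • a i : ℝ) : AddCircle (1 : ℝ)) = ∑ i ∈ s, n i • (a i : AddCircle (1 : ℝ)) := by
  have := map_sum (QuotientAddGroup.mk' (AddSubgroup.zmultiples (1 : ℝ))) (fun i => n i • a i) s
  exact this

theorem choose_idx (d k : ℕ) (α : Fin d → AddCircle (1 : ℝ))
    (hα : Dense (Set.range fun n : ℤ => n • α)) (β : Fin k → AddCircle (1 : ℝ)) :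
    ∃ ι : Fin (d - k) → Fin d, StrictMono ι ∧ ∀ (n : Fin (d - k) → ℤ) (m : Fin k → ℤ),
      ∑ i, n i • α (ι i) + ∑ j, m j • β j = 0 → n = 0 := by
  choose a ha using fun i => QuotientAddGroup.mk_surjective (α i)
  choose b hb using fun i => QuotientAddGroup.mk_surjective (β i)
  obtain rfl : (fun i => (a i : AddCircle (1 : ℝ))) = α := funext ha
  obtain rfl : (fun i => (b i : AddCircle (1 : ℝ))) = β := funext hb
  let Q : Submodule ℚ ℝ := Submodule.span ℚ {1}
  have hQ : ∀ z : ℤ, (z : ℝ) ∈ Q := fun z =>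
    Submodule.mem_span_singleton.2 ⟨z, by simp [Rat.smul_def]⟩
  have hli : LinearIndependent ℚ (fun i => Q.mkQ (a i)) := by
    rw [← LinearIndependent.iff_fractionRing ℤ ℚ, Fintype.linearIndependent_iff]
    intro n hn
    have h1 : ∑ i, n i • a i ∈ Q := by
      rw [← Submodule.ker_mkQ Q, LinearMap.mem_ker, map_sum]
      rw [← hn]
      exact Finset.sum_congr rfl fun i _ => map_zsmul _ _ _
    obtain ⟨q, hq⟩ := Submodule.mem_span_singleton.1 h1
    have h2 := indep_of_dense _ hα (fun i => (q.den : ℤ) * n i) (by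
      rw [← coe_sum', AddCircle.coe_eq_zero_iff]
      refine ⟨q.num, ?_⟩
      simp_rw [mul_smul]
      rw [← Finset.smul_sum, ← hq]
      simp only [Rat.smul_def, zsmul_eq_mul, mul_one, Int.cast_natCast]
      exact_mod_cast (Rat.den_mul_eq_num q).symm)
    intro i
    have h3 := congrFun h2 i
    simpa using h3
  let W : Submodule ℚ (ℝ ⧸ Q) := Submodule.span ℚ (Set.range fun j => Q.mkQ (b j))
  have : FiniteDimensional ℚ W := FiniteDimensional.span_of_finite ℚ (Set.finite_range _)
  obtain ⟨ι, hι, hl⟩ := linalg (k := k) _ hli W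
    ((finrank_range_le_card _).trans (by simp))
  refine ⟨ι, hι, fun n m h => ?_⟩
  rw [← LinearIndependent.iff_fractionRing ℤ ℚ, Fintype.linearIndependent_iff] at hl
  funext i
  refine hl n ?_ i
  rw [← coe_sum', ← coe_sum', ← AddCircle.coe_add, AddCircle.coe_eq_zero_iff] at h
  obtain ⟨z, hz⟩ := h
  have h4 : Q.mkQ (∑ i, n i • a (ι i)) = - ∑ j, m j • Q.mkQ (b j) := by
    have h5 : ∑ i, n i • a (ι i) = z - ∑ j, m j • b j := by
      rw [eq_sub_iff_add_eq, ← hz]; simp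
    have h6 : Q.mkQ (z : ℝ) = 0 := by
      rw [← LinearMap.mem_ker, Submodule.ker_mkQ]; exact hQ z
    rw [h5, map_sub, h6, zero_sub, map_sum]
    congr 1
  have h7 : W.mkQ (Q.mkQ (∑ i, n i • a (ι i))) = 0 := by
    rw [← LinearMap.mem_ker, Submodule.ker_mkQ, h4]
    have h8 : ∀ j, Q.mkQ (b j) ∈ W := fun j => Submodule.subset_span ⟨j, rfl⟩
    exact W.neg_mem (W.sum_mem fun j _ => zsmul_mem (h8 j) _)
  rw [map_sum, map_sum] at h7
  rw [← h7]
  refine Finset.sum_congr rfl fun i _ => ?_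
  rw [map_zsmul, map_zsmul]

theorem stmt18 (d k : ℕ) (hkd : k < d) (α : Fin d → AddCircle (1 : ℝ))
    (hα : Dense (Set.range fun n : ℤ => n • α)) (β : Fin k → AddCircle (1 : ℝ)) :
    ∃ ι : Fin (d - k) → Fin d, StrictMono ι ∧ DisjointPair (α ∘ ι) β := by
  obtain ⟨ι, hι, h⟩ := choose_idx d k α hα β
  refine ⟨ι, hι, ?_⟩
  unfold DisjointPair
  rw [← closure_prod_eq]
  apply subset_antisymm
  · apply closure_mono
    rintro _ ⟨n, rfl⟩
    exact ⟨⟨n, rfl⟩, ⟨n, rfl⟩⟩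
  · apply closure_minimal _ isClosed_closure
    rintro ⟨_, _⟩ ⟨⟨p, rfl⟩, ⟨q, rfl⟩⟩
    have hk := kron (Sum.elim (α ∘ ι) β) (Sum.elim (p • (α ∘ ι)) (q • β)) (by
      intro n hn
      simp only [Fintype.sum_sum_type, Sum.elim_inl, Sum.elim_inr, Pi.smul_apply,
        Function.comp] at hn ⊢
      have h0 := h (fun i => n (Sum.inl i)) (fun j => n (Sum.inr j)) hn
      have h1 : ∀ i, n (Sum.inl i) = 0 := fun i => congrFun h0 i
      simp only [h1, zero_smul, Finset.sum_const_zero, zero_add] at hn ⊢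
      simp_rw [smul_comm _ q]
      rw [← Finset.smul_sum, hn, smul_zero])
    let F : (Fin (d - k) ⊕ Fin k → AddCircle (1 : ℝ)) →
      (Fin (d - k) → AddCircle (1 : ℝ)) × (Fin k → AddCircle (1 : ℝ)) :=
      fun x => (fun i => x (Sum.inl i), fun j => x (Sum.inr j))
    have hF : Continuous F := by fun_prop
    refine map_mem_closure (f := F) hF hk ?_
    rintro _ ⟨n, rfl⟩
    exact ⟨n, rfl⟩
end
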